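/- arXiv:2511.05164 — 2 statements merged into one kernel-verified Lean document; each statement's English description precedes it below -/
import Mathlib

section
/- Let q ≥ 7 be a prime with q ≡ 3 (mod 4) and let χ be an irreducible complex character of PSL_2(q) of degree (q−1)/2. Then χ is not unisingular; more precisely, for any representation Φ affording χ there exists an element g of PSL_2(q) of order q such that Φ(g) does not have 1 as an eigenvalue. -/
open Module FDRep Matrix CategoryTheory

/-- A finite-dimensional complex representation of a group is *unisingular* if every group
element acts with `1` as an eigenvalue. -/
def FDRep.IsUnisingular {G : Type} [Monoid G] (V : FDRep ℂ G) : Prop :=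
  ∀ g : G, Module.End.HasEigenvalue (V.ρ g) 1


/-- `PSL₂(F)`, the projective special linear group of degree 2 over `F`:
the quotient of `SL₂(F)` by its center. -/
abbrev PSL2 (F : Type) [Field F] : Type _ :=
  Matrix.ProjectiveSpecialLinearGroup (Fin 2) F

open SpecialLinearGroup

namespace Module.End

variable {K V : Type*} [Field K] [AddCommGroup V] [Module K V]

theorem HasEigenvalue.one_of_pow_eq_one {f : End K V} {n : ℕ} (hf : f ^ n = 1) {μ : K}
    (hμ : f.HasEigenvalue μ) : μ ^ n = 1 := by
  obtain ⟨v, hv⟩ := hμ.exists_hasEigenvector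
  have h := hv.pow_apply n
  rw [hf, one_apply] at h
  by_contra hne
  exact hv.2 ((smul_eq_zero.1 (by rw [sub_smul, ← h, one_smul, sub_self] :
    (μ ^ n - 1) • v = 0)).resolve_left (sub_ne_zero.2 hne))

variable [FiniteDimensional K V]

/-- An endomorphism of finite order over an algebraically closed field of characteristic zero
is the identity if `1` is its only eigenvalue. -/
theorem eq_one_of_pow_eq_one [IsAlgClosed K] [CharZero K] {f : End K V} {n : ℕ} (hn : n ≠ 0)
    (hf : f ^ n = 1) (h : ∀ μ, f.HasEigenvalue μ → μ = 1) : f = 1 := by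
  have hss : f.IsSemisimple :=
    isSemisimple_of_squarefree_aeval_eq_zero (p := Polynomial.X ^ n - 1)
      (Polynomial.X_pow_sub_one_separable_iff.2 (Nat.cast_ne_zero.2 hn)).squarefree (by simp [hf])
  have htop : f.eigenspace 1 = ⊤ := by
    rw [← top_le_iff, ← hss.iSup_eigenspace_eq_top]
    refine iSup_le fun μ ↦ ?_
    by_cases hμ : f.HasEigenvalue μ
    · rw [h μ hμ]
    · rw [hasEigenvalue_iff, not_not] at hμ
      simp [hμ]
  ext v
  simpa using mem_eigenspace_iff.1 (htop ▸ Submodule.mem_top : v ∈ f.eigenspace 1)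

theorem HasEigenvalue.of_pow_semiconj {f : End K V} {P Q : End K V} (hPQ : P * Q = 1) {n : ℕ}
    (h : P * f = f ^ n * P) {μ : K} (hμ : f.HasEigenvalue μ) : f.HasEigenvalue (μ ^ n) := by
  obtain ⟨v, hv⟩ := hμ.exists_hasEigenvector
  have hPQv : P (Q v) = v := by simpa using congr($hPQ v)
  have hQP : Q * P = 1 := mul_eq_one_comm.1 hPQ
  refine hasEigenvalue_of_hasEigenvector (x := Q v) ⟨mem_eigenspace_iff.2 ?_, fun h0 ↦ hv.2 ?_⟩
  · have h1 : P (f (Q v)) = μ ^ n • v := by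
      have := congr($h (Q v))
      simp only [mul_apply, hPQv] at this
      rw [this, hv.pow_apply]
    have h2 := congr($hQP (f (Q v)))
    rw [mul_apply, h1, one_apply, map_smul] at h2
    exact h2.symm
  · rw [← hPQv, h0, map_zero]

theorem card_le_finrank_of_hasEigenvalue {ι : Type*} [Fintype ι] {f : End K V} {μ : ι → K}
    (hμ : Function.Injective μ) (h : ∀ i, f.HasEigenvalue (μ i)) :
    Fintype.card ι ≤ Module.finrank K V := by
  choose v hv using fun i ↦ (h i).exists_hasEigenvector
  exact (eigenvectors_linearIndependent' f μ hμ v hv).fintype_card_le_finrank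

/-- An endomorphism of odd prime order `q` that is conjugate to its powers with exponents
`t ^ 2` and has eigenvalue `1` lives on a space of dimension at least `(q + 1) / 2`, unless it
is trivial. -/
theorem lt_finrank_of_conj_pow_sq [IsAlgClosed K] [CharZero K] {q : ℕ} (hq : q.Prime) {f : End K V}
    (hf : f ^ q = 1) (hf1 : f ≠ 1)
    (hconj : ∀ t : ℕ, ¬ q ∣ t → ∃ P Q : End K V, P * Q = 1 ∧ P * f = f ^ t ^ 2 * P)
    (h1 : f.HasEigenvalue 1) : (q - 1) / 2 < Module.finrank K V := by
  obtain ⟨ζ, hζ, hζ1⟩ : ∃ ζ, f.HasEigenvalue ζ ∧ ζ ≠ 1 := by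
    by_contra! h
    exact hf1 (eq_one_of_pow_eq_one hq.ne_zero hf h)
  have := Fact.mk hq
  have hord : orderOf ζ = q := orderOf_eq_prime (hζ.one_of_pow_eq_one hf) hζ1
  have hcard := card_le_finrank_of_hasEigenvalue (f := f)
    (μ := fun t : Fin ((q - 1) / 2 + 1) ↦ ζ ^ (t : ℕ) ^ 2) ?_ ?_
  · simpa [Nat.succ_le_iff] using hcard
  · intro s t hst
    wlog hle : (s : ℕ) ≤ t generalizing s t
    · exact (this hst.symm (le_of_not_ge hle)).symm
    have hst' : ζ ^ ((t : ℕ) ^ 2 - (s : ℕ) ^ 2) = 1 := by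
      have hζ0 : ζ ≠ 0 := by
        rintro rfl
        simpa [hq.ne_zero] using hζ.one_of_pow_eq_one hf
      have hst2 : ζ ^ (s : ℕ) ^ 2 = ζ ^ (t : ℕ) ^ 2 := hst
      rw [pow_sub₀ _ hζ0 (Nat.pow_le_pow_left hle 2), ← hst2, mul_inv_cancel₀ (pow_ne_zero _ hζ0)]
    have hdvd := hord ▸ orderOf_dvd_of_pow_eq_one hst'
    rw [Nat.sq_sub_sq, hq.dvd_mul] at hdvd
    have hs := s.2
    have ht := t.2
    have hq2 := hq.two_le
    ext
    rcases hdvd with h | h <;> have := Nat.eq_zero_of_dvd_of_lt h (by omega) <;> omega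
  · intro t
    rcases Nat.eq_zero_or_pos (t : ℕ) with h0 | hpos
    · simpa [h0] using h1
    · have ht := t.2
      obtain ⟨P, Q, hPQ, h⟩ := hconj t (Nat.not_dvd_of_pos_of_lt hpos (by omega))
      exact hζ.of_pow_semiconj hPQ h

end Module.End

namespace Matrix.SpecialLinearGroup

theorem transvection_natCast {ι R : Type*} [DecidableEq ι] [Fintype ι] [CommRing R] {i j : ι}
    (hij : i ≠ j) (n : ℕ) :
    transvection hij (n : R) = transvection hij 1 ^ n := by
  induction n with
  | zero => simp
  | succ n ih => rw [Nat.cast_succ, transvection_add, ih, pow_succ]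

theorem diag2_mul_transvection {F : Type*} [Field F] {a : F} (ha : a ≠ 0) (b : F) :
    diag2 a ha * transvection zero_ne_one b = transvection zero_ne_one (a ^ 2 * b) * diag2 a ha := by
  apply Subtype.ext
  rw [coe_mul, coe_mul, diag2_coe', transvection_coe, transvection_coe]
  ext i j
  fin_cases i <;> fin_cases j <;> simp [Matrix.mul_apply, Fin.sum_univ_two]
  field_simp

end Matrix.SpecialLinearGroup

theorem FDRep.finrank_eq_one_of_simple_of_ρ_eq_one {G : Type} [Group G] [Finite G] {V : FDRep ℂ G}
    (hV : Simple V) (h : ∀ g, V.ρ g = 1) : Module.finrank ℂ V = 1 := by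
  have := Fintype.ofFinite G
  have hG : (Fintype.card G : ℂ) ≠ 0 := Nat.cast_ne_zero.2 Fintype.card_ne_zero
  have hsum := (simple_iff_char_is_norm_one V).1 hV
  have hchar (g : G) : V.character g = Module.finrank ℂ V := by
    rw [character, h, LinearMap.trace_one]
  simp only [hchar, Finset.sum_const, Finset.card_univ, nsmul_eq_mul, Nat.card_eq_fintype_card]
    at hsum
  have hsq := mul_left_cancel₀ hG (hsum.trans (mul_one _).symm)
  exact Nat.eq_one_of_mul_eq_one_left (by exact_mod_cast hsq)

/-- Let `F` be a finite field with `q` elements, where `q ≥ 7` is a prime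
with `q ≡ 3 (mod 4)`. Every irreducible complex character of `PSL₂(q)` of degree
`(q - 1) / 2` is not unisingular; more precisely, there is an element `g` of order `q`
acting without the eigenvalue `1`. -/
theorem PSL2_not_unisingular_of_deg_half_q_sub_one (q : ℕ) (hq : q.Prime) (h7 : 7 ≤ q)
    (h3 : q % 4 = 3)
    (F : Type) [Field F] [Fintype F] (hF : Fintype.card F = q)
    (V : FDRep ℂ (PSL2 F)) (hV : Simple V)
    (hdeg : Module.finrank ℂ V = (q - 1) / 2) :
    ¬ V.IsUnisingular ∧
      ∃ g : PSL2 F, orderOf g = q ∧ ¬ Module.End.HasEigenvalue (V.ρ g) 1 := by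
  have := Fact.mk hq
  have hp : CharP F q := charP_of_card_eq_prime (by rw [hF])
  let u : PSL2 F := QuotientGroup.mk (transvection zero_ne_one 1)
  have hu_pow (n : ℕ) : u ^ n = QuotientGroup.mk (transvection zero_ne_one (n : F)) := by
    rw [transvection_natCast, QuotientGroup.mk_pow]
  have hu_q : u ^ q = 1 := by simp [hu_pow]
  have hu_ne : u ≠ 1 := by
    rw [Ne, QuotientGroup.eq_one_iff, transvection_mem_center_iff]
    exact one_ne_zero
  have hρ : V.ρ u ≠ 1 := by
    intro h1
    have : IsSimpleGroup (PSL2 F) :=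
      Matrix.ProjectiveSpecialLinearGroup.rank_two_simple (by rw [Nat.card_eq_fintype_card]; omega)
    rcases (inferInstance : V.ρ.ker.Normal).eq_bot_or_eq_top with hbot | htop
    · exact hu_ne (Subgroup.mem_bot.1 (hbot ▸ MonoidHom.mem_ker.2 h1))
    · have := finrank_eq_one_of_simple_of_ρ_eq_one hV
        fun g ↦ MonoidHom.mem_ker.1 (htop ▸ Subgroup.mem_top g)
      omega
  have hu : ¬ Module.End.HasEigenvalue (V.ρ u) 1 := by
    intro h1
    refine (Module.End.lt_finrank_of_conj_pow_sq hq ?_ hρ (fun t ht ↦ ?_) h1).ne' hdeg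
    · rw [← map_pow, hu_q, map_one]
    · have ht0 : (t : F) ≠ 0 := by rwa [Ne, CharP.cast_eq_zero_iff F q]
      let d : PSL2 F := QuotientGroup.mk (diag2 (t : F) ht0)
      refine ⟨V.ρ d, V.ρ d⁻¹, by rw [← map_mul, mul_inv_cancel, map_one], ?_⟩
      rw [← map_pow, ← map_mul, ← map_mul, hu_pow, ← QuotientGroup.mk_mul, ← QuotientGroup.mk_mul,
        diag2_mul_transvection, mul_one, Nat.cast_pow]
  exact ⟨fun h ↦ hu (h u), u, orderOf_eq_prime hu_q hu_ne, hu⟩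
end

section
/- Let q ≥ 5 be an odd prime and let χ be an irreducible complex character of PSL_2(q) of degree q−1. Then χ is not unisingular; more precisely, for any representation Φ affording χ there exists an element g of PSL_2(q) of order q such that Φ(g) does not have 1 as an eigenvalue. -/
open Module FDRep Matrix CategoryTheory

namespace PSL2Unisingular

open scoped MatrixGroups

section Matrices

variable {F : Type*} [Field F]

/-- The upper unitriangular matrix with upper right entry `t`. -/
def upper (t : F) : SL(2, F) := ⟨!![1, t; 0, 1], by simp⟩

/-- The diagonal matrix with entries `a⁻¹` and `a`. -/
def diag (a : Fˣ) : SL(2, F) := ⟨!![(a⁻¹ : F), 0; 0, a], by simp⟩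

/-- The standard representative of the nontrivial Weyl group element. -/
def weyl : SL(2, F) := ⟨!![0, 1; -1, 0], by simp⟩

@[simp] lemma coe_upper (t : F) : (upper t : Matrix (Fin 2) (Fin 2) F) = !![1, t; 0, 1] := rfl

@[simp] lemma coe_diag (a : Fˣ) :
    (diag a : Matrix (Fin 2) (Fin 2) F) = !![(a⁻¹ : F), 0; 0, a] := rfl

@[simp] lemma coe_weyl : ((weyl : SL(2, F)) : Matrix (Fin 2) (Fin 2) F) = !![0, 1; -1, 0] := rfl

lemma upper_zero : upper (0 : F) = 1 := by
  ext i j; fin_cases i <;> fin_cases j <;> simp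

lemma upper_add (s t : F) : upper (s + t) = upper s * upper t := by
  ext i j; fin_cases i <;> fin_cases j <;> simp [add_comm]

lemma upper_natCast (n : ℕ) : upper (n : F) = upper 1 ^ n := by
  induction n with
  | zero => simp [upper_zero]
  | succ n ih => rw [Nat.cast_succ, upper_add, ih, pow_succ]

lemma upper_one_pow_char (q : ℕ) [CharP F q] : upper (1 : F) ^ q = 1 := by
  rw [← upper_natCast, CharP.cast_eq_zero, upper_zero]

lemma diag_one : diag (1 : Fˣ) = 1 := by
  ext i j; fin_cases i <;> fin_cases j <;> simp

lemma diag_mul (a b : Fˣ) : diag (a * b) = diag a * diag b := by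
  ext i j; fin_cases i <;> fin_cases j <;> simp [mul_comm]

lemma diag_neg_one : diag (-1 : Fˣ) = -1 := by
  ext i j; fin_cases i <;> fin_cases j <;> simp

lemma upper_mul_diag (a : Fˣ) (t : F) : upper t * diag a = diag a * upper (a ^ 2 * t) := by
  ext i j; fin_cases i <;> fin_cases j <;> simp
  field_simp

lemma diag_mul_upper (a : Fˣ) (t : F) : diag a * upper t = upper (a⁻¹ ^ 2 * t) * diag a := by
  rw [upper_mul_diag]; congr 2; simp

lemma weyl_mul_weyl : (weyl : SL(2, F)) * weyl = -1 := by
  ext i j; fin_cases i <;> fin_cases j <;> simp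

lemma weyl_eq_mul : (weyl : SL(2, F)) = upper 1 * weyl * upper 1 * weyl⁻¹ * upper 1 := by
  ext i j; fin_cases i <;> fin_cases j <;>
    simp [Matrix.adjugate_fin_two]

lemma eq_upper_mul_of_row_eq {g h : SL(2, F)} (hgh : g.1 1 = h.1 1) :
    ∃ t, g = upper t * h := by
  have hd : h.1 0 0 * h.1 1 1 - h.1 0 1 * h.1 1 0 = 1 := by
    rw [← Matrix.det_fin_two]; exact h.2
  have hd' : g.1 0 0 * h.1 1 1 - g.1 0 1 * h.1 1 0 = 1 := by
    rw [← hgh, ← Matrix.det_fin_two]; exact g.2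
  refine ⟨g.1 0 1 * h.1 0 0 - g.1 0 0 * h.1 0 1, ?_⟩
  ext i j
  fin_cases i
  · fin_cases j
    · simp [Matrix.mul_apply, Fin.sum_univ_two]
      linear_combination (-g.1 0 0) * hd + h.1 0 0 * hd'
    · simp [Matrix.mul_apply, Fin.sum_univ_two]
      linear_combination (-g.1 0 1) * hd + h.1 0 1 * hd'
  · simpa [Matrix.mul_apply, Fin.sum_univ_two] using congrFun hgh j

lemma exists_row_eq {v : Fin 2 → F} (hv : v ≠ 0) : ∃ g : SL(2, F), g.1 1 = v := by
  have hcop : IsCoprime (v 0) (v 1) := by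
    by_cases h0 : v 0 = 0
    · have h1 : v 1 ≠ 0 := fun h1 ↦ hv (by ext i; fin_cases i <;> simp [h0, h1])
      exact ⟨0, (v 1)⁻¹, by simp [h1]⟩
    · exact ⟨(v 0)⁻¹, 0, by simp [h0]⟩
  obtain ⟨g, h0, h1⟩ := hcop.exists_SL2_row 1
  exact ⟨g, by ext i; fin_cases i; exacts [h0, h1]⟩

lemma upper_one_not_mem_center : upper (1 : F) ∉ Subgroup.center SL(2, F) := by
  intro h
  have := congr($(Matrix.SpecialLinearGroup.scalar_eq_self_of_mem_center h 0) 0 1)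
  simp at this

end Matrices

section DegreeTwo

/-- An involution of determinant one of a two-dimensional space is a scalar. -/
lemma exists_eq_smul_one_of_sq_eq_one {k K : Type*} [Field k] [NeZero (2 : k)] [AddCommGroup K]
    [Module k K] (hK : finrank k K = 2) {W : Module.End k K} (hW : W * W = 1)
    (hdet : LinearMap.det W = 1) : ∃ s : k, W = s • 1 := by
  have : FiniteDimensional k K := FiniteDimensional.of_finrank_eq_succ hK
  let b := finBasisOfFinrankEq k K hK
  set M := LinearMap.toMatrix b b W with hM
  have h1 : M * M = 1 := by
    rw [hM, ← LinearMap.toMatrix_mul, hW, LinearMap.toMatrix_one]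
  have h2 : M.det = 1 := by rw [hM, LinearMap.det_toMatrix, hdet]
  have e00 := congr($h1 0 0)
  have e01 := congr($h1 0 1)
  have e10 := congr($h1 1 0)
  have e11 := congr($h1 1 1)
  simp only [Matrix.mul_apply, Fin.sum_univ_two, Matrix.one_apply_eq, ne_eq, zero_ne_one,
    one_ne_zero, not_false_eq_true, Matrix.one_apply_ne] at e00 e01 e10 e11
  rw [Matrix.det_fin_two] at h2
  have h3 : M 0 0 * (M 0 0 + M 1 1) = 2 := by linear_combination e00 + h2
  have htr : M 0 0 + M 1 1 ≠ 0 := fun h ↦ two_ne_zero (α := k) (by rw [← h3, h, mul_zero])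
  have h01 : M 0 1 = 0 := (mul_eq_zero.1 (by linear_combination e01)).resolve_right htr
  have h10 : M 1 0 = 0 := (mul_eq_zero.1 (by linear_combination e10)).resolve_right htr
  have h11 : M 1 1 = M 0 0 := sub_eq_zero.1 <|
    (mul_eq_zero.1 (by linear_combination e11 - e00)).resolve_right htr
  refine ⟨M 0 0, (LinearMap.toMatrix b b).injective ?_⟩
  rw [← hM, map_smul, LinearMap.toMatrix_one]
  ext i j
  fin_cases i <;> fin_cases j <;> simp [h01, h10, h11]

lemma upper_one_eq_one_of_finrank_eq_two {F K : Type*} [Field F] [AddCommGroup K] [Module ℂ K]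
    {q : ℕ} [CharP F q] (hq : q.Prime) (h5 : 5 ≤ q) (ρ : Representation ℂ SL(2, F) K)
    (hK : finrank ℂ K = 2) (hneg : ρ (-1) = 1) : ρ (upper 1) = 1 := by
  have hpow : ρ (upper 1) ^ q = 1 := by rw [← map_pow, upper_one_pow_char, map_one]
  have hcop : ∀ n, n < q → n ≠ 0 → n.Coprime q := fun n hn h0 ↦
    (Nat.coprime_of_lt_prime h0 hn hq).symm
  have h2 : (2 : F) ≠ 0 := fun h ↦ by
    have := (CharP.cast_eq_zero_iff F q 2).1 (by exact_mod_cast h)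
    exact absurd (Nat.le_of_dvd two_pos this) (by omega)
  have hdetdiag : LinearMap.det (ρ (diag (Units.mk0 2 h2))) ≠ 0 := by
    have : LinearMap.det (ρ (diag (Units.mk0 2 h2))) *
        LinearMap.det (ρ (diag (Units.mk0 2 h2))⁻¹) = 1 := by
      rw [← map_mul, ← map_mul, mul_inv_cancel, map_one, map_one]
    exact left_ne_zero_of_mul_eq_one this
  have hdet3 : LinearMap.det (ρ (upper 1)) ^ 3 = 1 := by
    have h := congr(LinearMap.det (ρ $(upper_mul_diag (Units.mk0 (2 : F) h2) 1)))
    have h4 : upper (((Units.mk0 (2 : F) h2 : Fˣ) : F) ^ 2 * 1) = upper 1 ^ 4 := by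
      rw [← upper_natCast]; congr 1; norm_num
    rw [h4] at h
    simp only [map_mul, map_pow] at h
    have hu : LinearMap.det (ρ (upper 1)) ≠ 0 := by
      intro h0
      have := congr(LinearMap.det $hpow)
      rw [map_pow, h0, map_one, zero_pow hq.ne_zero] at this
      exact zero_ne_one this
    apply mul_left_cancel₀ (mul_ne_zero hdetdiag hu)
    linear_combination -h
  have hdet : LinearMap.det (ρ (upper 1)) = 1 := by
    have h := congr(LinearMap.det $hpow)
    rw [map_pow, map_one] at h
    simpa [(hcop 3 (by omega) (by omega)).gcd_eq_one] using pow_gcd_eq_one.2 ⟨hdet3, h⟩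
  have hww : ρ weyl * ρ weyl = 1 := by rw [← map_mul, weyl_mul_weyl, hneg]
  have hwi : ρ weyl * ρ weyl⁻¹ = 1 := by rw [← map_mul, mul_inv_cancel, map_one]
  have hweyl : ρ weyl = ρ (upper 1) * ρ weyl * ρ (upper 1) * ρ weyl⁻¹ * ρ (upper 1) := by
    simp only [← map_mul, ← weyl_eq_mul]
  have hdetw : LinearMap.det (ρ weyl) = 1 := by
    have hi := congr(LinearMap.det $hwi)
    have h := congr(LinearMap.det $hweyl)
    simp only [map_mul, hdet, map_one, one_mul, mul_one] at h hi
    rw [h, hi]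
  obtain ⟨s, hs⟩ := exists_eq_smul_one_of_sq_eq_one hK hww hdetw
  have hw3 : ρ weyl = ρ (upper 1) ^ 3 := by
    have hc : ρ weyl * ρ (upper 1) = ρ (upper 1) * ρ weyl := by rw [hs]; simp
    calc ρ weyl = ρ (upper 1) * (ρ weyl * ρ (upper 1)) * ρ weyl⁻¹ * ρ (upper 1) := by
          rw [← mul_assoc, ← hweyl]
      _ = ρ (upper 1) * ρ (upper 1) * (ρ weyl * ρ weyl⁻¹) * ρ (upper 1) := by
          rw [hc]; simp only [mul_assoc]
      _ = ρ (upper 1) ^ 3 := by rw [hwi, mul_one, pow_succ, pow_two]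
  have h6 : ρ (upper 1) ^ 6 = 1 := by
    rw [show 6 = 3 + 3 from rfl, pow_add, ← hw3, hww]
  have h6q : Nat.Coprime 6 q :=
    (hcop 2 (by omega) (by omega)).mul_left (hcop 3 (by omega) (by omega))
  simpa [h6q.gcd_eq_one] using pow_gcd_eq_one.2 ⟨h6, hpow⟩

end DegreeTwo

lemma exists_natCast_eq {F : Type*} [Field F] [Fintype F] {q : ℕ} [NeZero q] [CharP F q]
    (hF : Fintype.card F = q) (t : F) : ∃ n : ℕ, (n : F) = t := by
  obtain ⟨x, hx⟩ := ((Fintype.bijective_iff_injective_and_card (ZMod.castHom dvd_rfl F)).2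
    ⟨ZMod.castHom_injective F, by rw [ZMod.card, hF]⟩).2 t
  exact ⟨x.val, by rw [← hx, ZMod.castHom_apply, ZMod.natCast_val]⟩

section PrincipalSeries

variable {F : Type*} [Field F]

/-- The action of `SL₂(F)` on functions of row vectors by right translation. -/
def rightTranslation (F : Type*) [Field F] :
    Representation ℂ SL(2, F) ((Fin 2 → F) → ℂ) where
  toFun g := LinearMap.funLeft ℂ ℂ fun v ↦ v ᵥ* g.1
  map_one' := by ext; simp [LinearMap.funLeft_apply]
  map_mul' g h := LinearMap.ext fun φ ↦ funext fun v ↦ by simp [LinearMap.funLeft_apply]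

lemma rightTranslation_apply (g : SL(2, F)) (φ : (Fin 2 → F) → ℂ) (v : Fin 2 → F) :
    rightTranslation F g φ v = φ (v ᵥ* g.1) := rfl

/-- The functions of row vectors which are homogeneous with respect to a multiplicative
character `χ`: this is the space of a principal series representation of `SL₂(F)`. -/
def principalSeries (χ : MulChar F ℂ) : Submodule ℂ ((Fin 2 → F) → ℂ) where
  carrier := {φ | ∀ (a : F) (v : Fin 2 → F), φ (a • v) = χ a * φ v}
  add_mem' hφ hψ a v := by simp only [Pi.add_apply, hφ a v, hψ a v, mul_add]
  zero_mem' a v := by simp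
  smul_mem' c φ hφ a v := by simp only [Pi.smul_apply, smul_eq_mul, hφ a v]; ring

variable {χ : MulChar F ℂ}

lemma principalSeries_le_comap (g : SL(2, F)) :
    principalSeries χ ≤ (principalSeries χ).comap (rightTranslation F g) := fun φ hφ a v ↦ by
  simp only [rightTranslation_apply, Matrix.smul_vecMul, hφ a]

open Classical in
lemma apply_eq_of_mem_principalSeries {φ : (Fin 2 → F) → ℂ} (hφ : φ ∈ principalSeries χ)
    (v : Fin 2 → F) :
    φ v = if v 0 = 0 then χ (v 1) * φ ![0, 1] else χ (v 0) * φ ![1, v 1 / v 0] := by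
  split_ifs with h
  · rw [← hφ]; congr 1; ext i; fin_cases i <;> simp [h]
  · rw [← hφ]; congr 1; ext i; fin_cases i <;> simp [h, mul_div_cancel₀]

/-- A homogeneous function is determined by its values on representatives of the points of the
projective line, and these can be prescribed. -/
noncomputable def principalSeriesEquiv (χ : MulChar F ℂ) :
    principalSeries χ ≃ₗ[ℂ] (Option F → ℂ) := by
  classical
  exact
  { toFun := fun φ o ↦ o.elim (φ.1 ![0, 1]) fun t ↦ φ.1 ![1, t]
    map_add' := fun φ ψ ↦ by ext o; cases o <;> rfl
    map_smul' := fun c φ ↦ by ext o; cases o <;> rfl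
    invFun := fun c ↦ ⟨fun v ↦ if v 0 = 0 then χ (v 1) * c none
      else χ (v 0) * c (some (v 1 / v 0)), fun a v ↦ by
        by_cases ha : a = 0
        · simp [ha, χ.map_zero]
        · by_cases hv : v 0 = 0 <;> simp [ha, hv, mul_assoc, mul_div_mul_left]⟩
    left_inv := fun φ ↦ by
      ext v
      exact (apply_eq_of_mem_principalSeries φ.2 v).symm
    right_inv := fun c ↦ by ext o; cases o <;> simp }

instance [Finite F] : FiniteDimensional ℂ (principalSeries χ) :=
  (principalSeriesEquiv χ).symm.finiteDimensional

lemma finrank_principalSeries [Fintype F] :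
    finrank ℂ (principalSeries χ) = Fintype.card F + 1 := by
  classical
  rw [(principalSeriesEquiv χ).finrank_eq, Module.finrank_fintype_fun_eq_card,
    Fintype.card_option]

/-- The principal series representation of `SL₂(F)` attached to `χ`. -/
noncomputable def principalSeriesRep (χ : MulChar F ℂ) :
    Representation ℂ SL(2, F) (principalSeries χ) :=
  (rightTranslation F).subrepresentation (principalSeries χ) principalSeries_le_comap

lemma principalSeriesRep_apply (g : SL(2, F)) (φ : principalSeries χ) (v : Fin 2 → F) :
    (principalSeriesRep χ g φ).1 v = φ.1 (v ᵥ* g.1) := rfl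

lemma principalSeriesRep_neg_one (hχ : χ (-1) = 1) : principalSeriesRep χ (-1) = 1 := by
  refine LinearMap.ext fun φ ↦ Subtype.ext (funext fun v ↦ ?_)
  rw [principalSeriesRep_apply]
  have := φ.2 (-1) v
  simpa [Matrix.vecMul_neg, hχ] using this

lemma finrank_le_two_of_upper_one_fixed {q : ℕ} [NeZero q] [CharP F q] [Fintype F]
    (hF : Fintype.card F = q) {N : Submodule ℂ (principalSeries χ)}
    (hN : ∀ φ ∈ N, principalSeriesRep χ (upper 1) φ = φ) : finrank ℂ N ≤ 2 := by
  let e : N →ₗ[ℂ] Fin 2 → ℂ :=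
    { toFun := fun φ ↦ ![φ.1.1 ![0, 1], φ.1.1 ![1, 0]]
      map_add' := fun φ ψ ↦ by ext i; fin_cases i <;> rfl
      map_smul' := fun c φ ↦ by ext i; fin_cases i <;> rfl }
  have he : Function.Injective e := by
    have hinj := injective_iff_map_eq_zero e
    refine hinj.2 fun φ hφ ↦ ?_
    have h0 : φ.1.1 ![0, 1] = 0 := congrFun hφ 0
    have h1 : φ.1.1 ![1, 0] = 0 := congrFun hφ 1
    have hfix : principalSeriesRep χ (upper 1) φ.1 = φ.1 := hN φ.1 φ.2
    have hshift (t : F) : φ.1.1 ![1, t + 1] = φ.1.1 ![1, t] := by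
      have := congr(($hfix).1 ![1, t])
      rw [principalSeriesRep_apply] at this
      rw [← this]
      refine congrArg _ (funext fun i ↦ ?_)
      fin_cases i <;> simp [Matrix.vecMul, dotProduct, Fin.sum_univ_two, add_comm]
    have hnat (n : ℕ) : φ.1.1 ![1, (n : F)] = 0 := by
      induction n with
      | zero => simpa using h1
      | succ n ih => rw [Nat.cast_succ, hshift, ih]
    have hall (t : F) : φ.1.1 ![1, t] = 0 := by
      obtain ⟨n, rfl⟩ := exists_natCast_eq hF t
      exact hnat n
    ext v
    rw [apply_eq_of_mem_principalSeries φ.1.2, h0, hall]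
    simp
  simpa using LinearMap.finrank_le_finrank_of_injective he

end PrincipalSeries

section Embedding

variable {F W : Type*} [Field F] [AddCommGroup W] [Module ℂ W] (ρ : Representation ℂ SL(2, F) W)

lemma apply_upper_eq_of_apply_upper_one_eq [Fintype F] {q : ℕ} [NeZero q] [CharP F q]
    (hF : Fintype.card F = q) {l : Dual ℂ W} (hl : ∀ x, l (ρ (upper 1) x) = l x) (t : F) (x : W) : l (ρ (upper t) x) = l x := by
  obtain ⟨n, rfl⟩ := exists_natCast_eq hF t
  rw [upper_natCast]
  induction n with
  | zero => simp
  | succ n ih => rw [pow_succ', map_mul, Module.End.mul_apply, hl, ih]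

lemma exists_upper_invariant_functional [FiniteDimensional ℂ W] {v : W} (hv : v ≠ 0)
    (hfix : ρ (upper 1) v = v) : ∃ l : Dual ℂ W, l ≠ 0 ∧ ∀ x, l (ρ (upper 1) x) = l x := by
  let T : Module.End ℂ W := ρ (upper 1) - 1
  have hrange : LinearMap.range T < ⊤ := by
    refine lt_top_iff_ne_top.2 fun h ↦ hv ?_
    exact LinearMap.injective_iff_surjective.2 (LinearMap.range_eq_top.1 h) (by simp [T, hfix])
  obtain ⟨l, hl0, hl⟩ := Submodule.exists_le_ker_of_lt_top _ hrange
  refine ⟨l, hl0, fun x ↦ sub_eq_zero.1 ?_⟩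
  have := hl (LinearMap.mem_range_self T x)
  simpa [T] using this

/-- A representation with a nonzero vector fixed by the unipotent upper triangular matrices has a
functional which is an eigenvector of the Borel subgroup, with trivial unipotent part. -/
lemma exists_borel_eigenfunctional [FiniteDimensional ℂ W] [Fintype F] {q : ℕ} [NeZero q]
    [CharP F q] (hF : Fintype.card F = q) {v : W} (hv : v ≠ 0) (hfix : ρ (upper 1) v = v) :
    ∃ (l : Dual ℂ W) (χ : MulChar F ℂ), l ≠ 0 ∧ (∀ (t : F) (x : W), l (ρ (upper t) x) = l x) ∧
      ∀ (a : Fˣ) (x : W), l (ρ (diag a) x) = χ a * l x := by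
  let D : Submodule ℂ (Dual ℂ W) :=
    { carrier := {l | ∀ x, l (ρ (upper 1) x) = l x}
      add_mem' := fun h h' x ↦ by simp [h x, h' x]
      zero_mem' := fun x ↦ by simp
      smul_mem' := fun c l h x ↦ by simp [h x] }
  obtain ⟨l₀, hl₀, hl₀'⟩ := exists_upper_invariant_functional ρ hv hfix
  have : Nontrivial D := ⟨⟨⟨l₀, hl₀'⟩, 0, fun h ↦ hl₀ congr(($h).1)⟩⟩
  obtain ⟨a₀, ha₀⟩ := IsCyclic.exists_monoid_generator (α := Fˣ)
  let T : Module.End ℂ D := (Dual.transpose (R := ℂ) (ρ (diag a₀))).restrict fun l hl x ↦ by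
    have hcomm : ρ (diag a₀) (ρ (upper 1) x) = ρ (upper (a₀⁻¹ ^ 2 * 1)) (ρ (diag a₀) x) := by
      rw [← Module.End.mul_apply, ← Module.End.mul_apply, ← map_mul, ← map_mul, diag_mul_upper]
    simp only [Dual.transpose_apply, LinearMap.comp_apply]
    rw [hcomm, apply_upper_eq_of_apply_upper_one_eq ρ hF hl]
  obtain ⟨μ, hμ⟩ := Module.End.exists_eigenvalue T
  obtain ⟨l, hl⟩ := hμ.exists_hasEigenvector
  have hl0 : l.1 ≠ 0 := fun h ↦ hl.2 (Subtype.ext h)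
  have hT (x : W) : l.1 (ρ (diag a₀) x) = μ * l.1 x := congr(($(hl.apply_eq_smul)).1 x)
  have hall (a : Fˣ) : ∃ c : ℂ, ∀ x, l.1 (ρ (diag a) x) = c * l.1 x := by
    obtain ⟨n, rfl⟩ := ha₀ a
    refine ⟨μ ^ n, ?_⟩
    induction n with
    | zero => simp [diag_one]
    | succ n ih =>
      intro x
      simp only at ih ⊢
      rw [pow_succ, diag_mul, map_mul, Module.End.mul_apply, ih, hT, pow_succ, mul_assoc]
  obtain ⟨x, hx⟩ : ∃ x, l.1 x ≠ 0 := by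
    by_contra! h
    exact hl0 (LinearMap.ext h)
  choose c hc using hall
  let α : Fˣ →* ℂ :=
    { toFun := c
      map_one' := mul_right_cancel₀ hx (by rw [← hc, diag_one]; simp)
      map_mul' := fun a b ↦ mul_right_cancel₀ hx (by
        rw [← hc, diag_mul, map_mul, Module.End.mul_apply, hc, hc, mul_assoc]) }
  refine ⟨l.1, MulChar.ofUnitHom α.toHomUnits, hl0,
    apply_upper_eq_of_apply_upper_one_eq ρ hF l.2, fun a y ↦ ?_⟩
  rw [hc, MulChar.ofUnitHom_coe]
  rfl

/-- An irreducible representation with a functional which is an eigenvector of the Borel subgroup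
embeds into a principal series representation. -/
lemma exists_injective_to_principalSeries
    (hirr : ∀ N : Submodule ℂ W, (∀ g, ∀ x ∈ N, ρ g x ∈ N) → N = ⊥ ∨ N = ⊤) {l : Dual ℂ W}
    {χ : MulChar F ℂ} (hl : l ≠ 0) (hupper : ∀ (t : F) (x : W), l (ρ (upper t) x) = l x)
    (hdiag : ∀ (a : Fˣ) (x : W), l (ρ (diag a) x) = χ a * l x) :
    ∃ f : W →ₗ[ℂ] principalSeries χ, Function.Injective f ∧
      ∀ g x, f (ρ g x) = principalSeriesRep χ g (f x) := by
  classical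
  choose r hr using fun v : {v : Fin 2 → F // v ≠ 0} ↦ exists_row_eq v.2
  have hrow (g h : SL(2, F)) (hgh : g.1 1 = h.1 1) (x : W) : l (ρ g x) = l (ρ h x) := by
    obtain ⟨t, rfl⟩ := eq_upper_mul_of_row_eq hgh
    rw [map_mul, Module.End.mul_apply, hupper]
  let φ (x : W) (v : Fin 2 → F) : ℂ := if h : v ≠ 0 then l (ρ (r ⟨v, h⟩) x) else 0
  have hφ0 (x : W) : φ x 0 = 0 := by simp [φ]
  have hrow_ne (g : SL(2, F)) : g.1 1 ≠ 0 := fun h ↦ by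
    have := g.2
    rw [Matrix.det_fin_two, h] at this
    simp at this
  have hφ (x : W) (g : SL(2, F)) : φ x (g.1 1) = l (ρ g x) := by
    simp only [φ, dif_pos (hrow_ne g)]
    exact hrow _ _ (hr ⟨_, hrow_ne g⟩) x
  have hφ_smul (x : W) : φ x ∈ principalSeries χ := by
    intro a v
    by_cases ha : a = 0
    · simp [ha, hφ0, χ.map_zero]
    by_cases hv : v = 0
    · simp [hv, hφ0]
    obtain ⟨g, rfl⟩ := exists_row_eq hv
    have hag : a • g.1 1 = (diag (Units.mk0 a ha) * g).1 1 := by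
      ext j
      simp [Matrix.mul_apply, Fin.sum_univ_two]
    rw [hag, hφ, hφ, map_mul, Module.End.mul_apply, hdiag, Units.val_mk0]
  have hφ_equiv (g : SL(2, F)) (x : W) (v : Fin 2 → F) : φ (ρ g x) v = φ x (v ᵥ* g.1) := by
    by_cases hv : v = 0
    · simp [hv, hφ0]
    obtain ⟨h, rfl⟩ := exists_row_eq hv
    have hhg : h.1 1 ᵥ* g.1 = (h * g).1 1 := by
      rw [Matrix.SpecialLinearGroup.coe_mul, Matrix.mul_apply_eq_vecMul]
    rw [hhg, hφ, hφ, map_mul, Module.End.mul_apply]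
  let f : W →ₗ[ℂ] principalSeries χ :=
    { toFun := fun x ↦ ⟨φ x, hφ_smul x⟩
      map_add' := fun x y ↦ Subtype.ext (funext fun v ↦ by
        by_cases hv : v = 0
        · simp [hv, hφ0]
        · simp [φ, hv])
      map_smul' := fun c x ↦ Subtype.ext (funext fun v ↦ by
        by_cases hv : v = 0
        · simp [hv, hφ0]
        · simp [φ, hv]) }
  have hf (g : SL(2, F)) (x : W) : f (ρ g x) = principalSeriesRep χ g (f x) :=
    Subtype.ext (funext fun v ↦ hφ_equiv g x v)
  refine ⟨f, ?_, hf⟩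
  rcases hirr (LinearMap.ker f) (fun g x hx ↦ by
    rw [LinearMap.mem_ker] at hx ⊢
    rw [hf, hx, map_zero]) with h | h
  · exact LinearMap.ker_eq_bot.1 h
  · refine absurd (LinearMap.ext fun x ↦ ?_) hl
    have hx : f x = 0 := LinearMap.mem_ker.1 (h ▸ Submodule.mem_top)
    have := hφ x 1
    rw [map_one, Module.End.one_apply] at this
    rw [← this]
    exact congr(($hx).1 _)

end Embedding

section Main

/-- If `u` acts unipotently modulo a subspace and has finite order, a `u`-fixed vector of the form
`u y - y` vanishes. -/
lemma eq_zero_of_fixed_of_sub_eq {W : Type*} [AddCommGroup W] [Module ℂ W] {q : ℕ} (hq : q ≠ 0)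
    {A : Module.End ℂ W} (hA : A ^ q = 1) {x y : W} (hx : A x = x) (hxy : A y - y = x) :
    x = 0 := by
  have hpow (n : ℕ) : (A ^ n) y = y + (n : ℂ) • x := by
    induction n with
    | zero => simp
    | succ n ih =>
      rw [pow_succ', Module.End.mul_apply, ih, map_add, map_smul, hx, ← sub_add_cancel (A y) y,
        hxy, Nat.cast_succ, add_smul, one_smul]
      abel
  have h := hpow q
  rw [hA, Module.End.one_apply, left_eq_add, smul_eq_zero, Nat.cast_eq_zero] at h
  exact h.resolve_left hq

lemma eq_zero_of_upper_one_fixed {F W : Type*} [Field F] [Fintype F] [AddCommGroup W] [Module ℂ W]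
    [FiniteDimensional ℂ W] {q : ℕ} [CharP F q] (hq : q.Prime) (h5 : 5 ≤ q)
    (hF : Fintype.card F = q) (ρ : Representation ℂ SL(2, F) W) (hneg : ρ (-1) = 1)
    (hirr : ∀ N : Submodule ℂ W, (∀ g, ∀ x ∈ N, ρ g x ∈ N) → N = ⊥ ∨ N = ⊤)
    (hdim : finrank ℂ W = q - 1) {v : W} (hfix : ρ (upper 1) v = v) : v = 0 := by
  by_contra hv
  have : NeZero q := ⟨hq.ne_zero⟩
  obtain ⟨l, χ, hl, hupper, hdiag⟩ := exists_borel_eigenfunctional ρ hF hv hfix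
  have hχ : χ (-1) = 1 := by
    obtain ⟨x, hx⟩ : ∃ x, l x ≠ 0 := by
      by_contra! h
      exact hl (LinearMap.ext h)
    have := hdiag (-1) x
    rw [diag_neg_one, hneg, Module.End.one_apply] at this
    simpa using mul_right_cancel₀ hx (this.symm.trans (one_mul _).symm)
  obtain ⟨f, hf, hfρ⟩ := exists_injective_to_principalSeries ρ hirr hl hupper hdiag
  let N := LinearMap.range f
  have hN (g : SL(2, F)) : N ≤ N.comap (principalSeriesRep χ g) := by
    rintro _ ⟨x, rfl⟩
    exact ⟨ρ g x, hfρ g x⟩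
  have hNdim : finrank ℂ N = q - 1 := by rw [LinearMap.finrank_range_of_inj hf, hdim]
  have hQdim : finrank ℂ (principalSeries χ ⧸ N) = 2 := by
    have := N.finrank_quotient_add_finrank
    rw [hNdim, finrank_principalSeries, hF] at this
    omega
  have hQneg : (principalSeriesRep χ).quotient N hN (-1) = 1 := by
    refine LinearMap.ext fun y ↦ ?_
    obtain ⟨y, rfl⟩ := N.mkQ_surjective y
    exact congrArg N.mkQ (LinearMap.congr_fun (principalSeriesRep_neg_one hχ) y)
  have hQ := upper_one_eq_one_of_finrank_eq_two hq h5 _ hQdim hQneg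
  let T : Module.End ℂ (principalSeries χ) := principalSeriesRep χ (upper 1) - 1
  have hT (y) : T y = principalSeriesRep χ (upper 1) y - y := rfl
  have hle : LinearMap.range T ≤ N := by
    rintro _ ⟨y, rfl⟩
    rw [hT]
    exact (Submodule.Quotient.eq N).1 (LinearMap.congr_fun hQ (N.mkQ y))
  have hker : finrank ℂ (LinearMap.ker T) ≤ 2 :=
    finrank_le_two_of_upper_one_fixed hF fun φ hφ ↦ sub_eq_zero.1 (LinearMap.mem_ker.1 hφ)
  have heq : LinearMap.range T = N := by
    refine Submodule.eq_of_le_of_finrank_le hle ?_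
    have := T.finrank_range_add_finrank_ker
    rw [finrank_principalSeries, hF] at this
    omega
  obtain ⟨y, hy⟩ : f v ∈ LinearMap.range T := heq ▸ LinearMap.mem_range_self f v
  refine hv (hf ?_)
  rw [map_zero]
  refine eq_zero_of_fixed_of_sub_eq hq.ne_zero ?_ (by rw [← hfρ, hfix]) hy
  rw [← map_pow, upper_one_pow_char, map_one]

/-- A stable subspace of a simple object of `FDRep` is trivial. -/
lemma eq_bot_or_eq_top_of_simple {G : Type} [Group G] (V : FDRep ℂ G) (hV : Simple V)
    (N : Submodule ℂ V) (hN : ∀ g, ∀ x ∈ N, V.ρ g x ∈ N) : N = ⊥ ∨ N = ⊤ := by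
  let σ : Representation ℂ G N := Representation.subrepresentation V.ρ N hN
  let i : FDRep.of σ ⟶ V := ⟨FGModuleCat.ofHom N.subtype, fun g ↦ rfl⟩
  have hmono : Mono i := ConcreteCategory.mono_of_injective i Subtype.val_injective
  by_cases hi : i = 0
  · left
    refine (Submodule.eq_bot_iff N).2 fun x hx ↦ ?_
    exact congr(($hi).hom.hom.hom ⟨x, hx⟩)
  · right
    have : IsIso i := (Simple.mono_isIso_iff_nonzero i).2 hi
    have hs : Function.Surjective N.subtype := (FDRep.isoToLinearEquiv (asIso i)).surjective
    simpa using LinearMap.range_eq_top.2 hs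

end Main

end PSL2Unisingular

open PSL2Unisingular
open scoped MatrixGroups

/-- Let `F` be a finite field with `q` elements, where `q ≥ 5` is an odd
prime. Every irreducible complex character of `PSL₂(q)` of degree `q - 1` is not
unisingular; more precisely, there is an element `g` of order `q` acting without the
eigenvalue `1`. -/
theorem PSL2_not_unisingular_of_deg_q_sub_one (q : ℕ) (hq : q.Prime) (hodd : Odd q)
    (h5 : 5 ≤ q)
    (F : Type) [Field F] [Fintype F] (hF : Fintype.card F = q)
    (V : FDRep ℂ (PSL2 F)) (hV : Simple V)
    (hdeg : Module.finrank ℂ V = q - 1) :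
    ¬ V.IsUnisingular ∧
      ∃ g : PSL2 F, orderOf g = q ∧ ¬ Module.End.HasEigenvalue (V.ρ g) 1 := by
  have : Fact q.Prime := ⟨hq⟩
  have : CharP F q := charP_of_card_eq_prime hF
  let ρ : Representation ℂ SL(2, F) V := V.ρ.comp (QuotientGroup.mk' _)
  have hneg : ρ (-1) = 1 := by
    have h : (-1 : SL(2, F)) ∈ Subgroup.center SL(2, F) :=
      Subgroup.mem_center_iff.2 fun g ↦ by simp
    have h' : QuotientGroup.mk' (Subgroup.center SL(2, F)) (-1) = 1 :=
      (QuotientGroup.eq_one_iff _).2 h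
    rw [MonoidHom.comp_apply, h', map_one]
  have hfix : ¬ Module.End.HasEigenvalue (V.ρ (upper (1 : F) : SL(2, F))) 1 := fun h ↦ by
    obtain ⟨v, hv⟩ := h.exists_hasEigenvector
    refine hv.2 (eq_zero_of_upper_one_fixed hq h5 hF ρ hneg (fun N hN ↦ ?_) hdeg ?_)
    · exact eq_bot_or_eq_top_of_simple V hV N fun g ↦
        QuotientGroup.induction_on g fun g ↦ hN g
    · exact hv.apply_eq_smul.trans (one_smul _ _)
  refine ⟨fun h ↦ hfix (h _), _, orderOf_eq_prime ?_ ?_, hfix⟩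
  · rw [← QuotientGroup.mk_pow, upper_one_pow_char, QuotientGroup.mk_one]
  · exact fun h ↦ upper_one_not_mem_center ((QuotientGroup.eq_one_iff _).1 h)
end
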